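/- Let T be a tree of order n(T) ≥ 3 with γ_t^{oi}(S(T)) = (4n(T) − l(T) + s(T) − 2)/3, and let v_k be a strong leaf of T. Then the tree T' = T − {v_k} satisfies γ_t^{oi}(S(T')) = (4n(T') − l(T') + s(T') − 2)/3. -/

import Mathlib

open SimpleGraph

universe u

/-- A total outer-independent dominating set: every vertex has a neighbor in `D`,
and the complement of `D` is an independent set. -/
def IsTOIDS {V : Type u} (G : SimpleGraph V) (D : Set V) : Prop :=
  (∀ v : V, ∃ u ∈ D, G.Adj v u) ∧ ∀ u ∉ D, ∀ w ∉ D, ¬ G.Adj u w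

/-- The total outer-independent domination number. -/
noncomputable def toidNumber {V : Type u} (G : SimpleGraph V) : ℕ :=
  sInf {n : ℕ | ∃ D : Set V, IsTOIDS G D ∧ D.ncard = n}

/-- The subdivision graph: each edge is replaced by a new vertex adjacent exactly to
its two endpoints. -/
def subdivision {V : Type u} (G : SimpleGraph V) : SimpleGraph (V ⊕ G.edgeSet) :=
  SimpleGraph.fromRel fun x y =>
    ∃ (v : V) (e : G.edgeSet), x = Sum.inl v ∧ y = Sum.inr e ∧ v ∈ (e : Sym2 V)

/-- A leaf: a vertex with exactly one neighbor. -/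
def IsLeafVert {V : Type u} (G : SimpleGraph V) (v : V) : Prop := ∃! u, G.Adj v u

/-- A support vertex: a vertex adjacent to a leaf. -/
def IsSupportVert {V : Type u} (G : SimpleGraph V) (v : V) : Prop :=
  ∃ u, G.Adj v u ∧ IsLeafVert G u

/-- A strong support vertex: a vertex adjacent to at least two leaves. -/
def IsStrongSupportVert {V : Type u} (G : SimpleGraph V) (v : V) : Prop :=
  ∃ u w, u ≠ w ∧ G.Adj v u ∧ G.Adj v w ∧ IsLeafVert G u ∧ IsLeafVert G w

/-- A strong leaf: a leaf adjacent to a strong support vertex. -/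
def IsStrongLeaf {V : Type u} (G : SimpleGraph V) (v : V) : Prop :=
  IsLeafVert G v ∧ ∃ u, G.Adj v u ∧ IsStrongSupportVert G u

/-- A weak leaf: a leaf that is not a strong leaf. -/
def IsWeakLeaf {V : Type u} (G : SimpleGraph V) (v : V) : Prop :=
  IsLeafVert G v ∧ ¬ IsStrongLeaf G v

/-- A semi-support vertex: neither a leaf nor a support vertex, but adjacent to a
support vertex. -/
def IsSemiSupportVert {V : Type u} (G : SimpleGraph V) (v : V) : Prop :=
  ¬ IsLeafVert G v ∧ ¬ IsSupportVert G v ∧ ∃ u, G.Adj v u ∧ IsSupportVert G u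

/-- The number of leaves, with the convention that `P₂` has exactly one leaf. -/
noncomputable def leafCount {V : Type u} (G : SimpleGraph V) : ℕ :=
  if Nat.card V = 2 then 1 else {v | IsLeafVert G v}.ncard

/-- The number of support vertices, with the convention that `P₂` has exactly one
support vertex. -/
noncomputable def supportCount {V : Type u} (G : SimpleGraph V) : ℕ :=
  if Nat.card V = 2 then 1 else {v | IsSupportVert G v}.ncard

/-- The graph obtained from `G` by attaching a path `P_r` to the vertex `v`:
the new vertices form a path `p₀ p₁ ⋯ p_{r-1}` and `v` is joined to the end `p₀`. -/
def attachPath {V : Type u} (G : SimpleGraph V) (v : V) (r : ℕ) :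
    SimpleGraph (V ⊕ Fin r) :=
  SimpleGraph.fromRel fun x y =>
    (∃ a b, x = Sum.inl a ∧ y = Sum.inl b ∧ G.Adj a b) ∨
    (∃ i j : Fin r, x = Sum.inr i ∧ y = Sum.inr j ∧ (j : ℕ) = (i : ℕ) + 1) ∨
    (∃ i : Fin r, x = Sum.inl v ∧ y = Sum.inr i ∧ (i : ℕ) = 0)

/-- The graph obtained from `G` by adding a disjoint copy of the tree `Q_r`
(`r` paths `P₃` joined to a central vertex) and identifying the central vertex
of `Q_r` with the vertex `v` of `G`. -/
def attachQ {V : Type u} (G : SimpleGraph V) (v : V) (r : ℕ) :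
    SimpleGraph (V ⊕ Fin r × Fin 3) :=
  SimpleGraph.fromRel fun x y =>
    (∃ a b, x = Sum.inl a ∧ y = Sum.inl b ∧ G.Adj a b) ∨
    (∃ i : Fin r, x = Sum.inl v ∧ y = Sum.inr (i, 0)) ∨
    (∃ (i : Fin r) (j k : Fin 3),
      x = Sum.inr (i, j) ∧ y = Sum.inr (i, k) ∧ (k : ℕ) = (j : ℕ) + 1)

/-- The family `F`: all trees obtainable from `P₂` by repeatedly
(F1) attaching `P₁` to a support vertex, (F2) attaching `P₂` to a support or
semi-support vertex, (F3) attaching `P₃` to a weak leaf. -/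
inductive InFamilyF : {W : Type u} → SimpleGraph W → Prop
  | base {W : Type u} (G : SimpleGraph W) (e : G ≃g SimpleGraph.pathGraph 2) :
      InFamilyF G
  | op1 {W : Type u} {G' : SimpleGraph W} {v : W} (hv : IsSupportVert G' v)
      (hF : InFamilyF G') {U : Type u} (G : SimpleGraph U)
      (e : G ≃g attachPath G' v 1) : InFamilyF G
  | op2 {W : Type u} {G' : SimpleGraph W} {v : W}
      (hv : IsSupportVert G' v ∨ IsSemiSupportVert G' v)
      (hF : InFamilyF G') {U : Type u} (G : SimpleGraph U)
      (e : G ≃g attachPath G' v 2) : InFamilyF G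
  | op3 {W : Type u} {G' : SimpleGraph W} {v : W} (hv : IsWeakLeaf G' v)
      (hF : InFamilyF G') {U : Type u} (G : SimpleGraph U)
      (e : G ≃g attachPath G' v 3) : InFamilyF G

/-- The family `𝒯`: all trees obtainable from `P₂` by repeatedly
(O1) attaching `P₁` to a support vertex, (O2) attaching `P₃` to a support vertex or a
weak leaf, (O3) adding a copy of `Q_r` (`r ≥ 2`) identifying its central vertex with a
weak leaf. -/
inductive InFamilyT : {W : Type u} → SimpleGraph W → Prop
  | base {W : Type u} (G : SimpleGraph W) (e : G ≃g SimpleGraph.pathGraph 2) :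
      InFamilyT G
  | op1 {W : Type u} {G' : SimpleGraph W} {v : W} (hv : IsSupportVert G' v)
      (hF : InFamilyT G') {U : Type u} (G : SimpleGraph U)
      (e : G ≃g attachPath G' v 1) : InFamilyT G
  | op2 {W : Type u} {G' : SimpleGraph W} {v : W}
      (hv : IsSupportVert G' v ∨ IsWeakLeaf G' v)
      (hF : InFamilyT G') {U : Type u} (G : SimpleGraph U)
      (e : G ≃g attachPath G' v 3) : InFamilyT G
  | op3 {W : Type u} {G' : SimpleGraph W} {v : W} (hv : IsWeakLeaf G' v)
      (hF : InFamilyT G') {r : ℕ} (hr : 2 ≤ r) {U : Type u} (G : SimpleGraph U)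
      (e : G ≃g attachQ G' v r) : InFamilyT G

/-- `A` (original vertices) and `B` (subdivided edges) together form a total outer-independent
dominating set of the subdivision of `G`. -/
structure IsSubdivisionTOIDS {V : Type u} (G : SimpleGraph V) (A : Set V) (B : Set (Sym2 V)) :
    Prop where
  subset : B ⊆ G.edgeSet
  dom_vertex : ∀ x, ∃ y, G.Adj x y ∧ s(x, y) ∈ B
  dom_edge : ∀ x y, G.Adj x y → x ∈ A ∨ y ∈ A
  indep : ∀ x y, G.Adj x y → x ∈ A ∨ s(x, y) ∈ B

theorem subdivision_adj_inl_inr {V : Type u} (G : SimpleGraph V) (x : V) (e : G.edgeSet) :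
    (subdivision G).Adj (Sum.inl x) (Sum.inr e) ↔ x ∈ (e : Sym2 V) := by
  simp [subdivision]

theorem not_subdivision_adj_inl_inl {V : Type u} (G : SimpleGraph V) (x y : V) :
    ¬ (subdivision G).Adj (Sum.inl x) (Sum.inl y) := by
  simp [subdivision]

theorem not_subdivision_adj_inr_inr {V : Type u} (G : SimpleGraph V) (e f : G.edgeSet) :
    ¬ (subdivision G).Adj (Sum.inr e) (Sum.inr f) := by
  simp [subdivision]

theorem isTOIDS_subdivision_iff {V : Type u} (G : SimpleGraph V) (A : Set V) (B : Set (Sym2 V))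
    (hB : B ⊆ G.edgeSet) :
    IsTOIDS (subdivision G) (Sum.inl '' A ∪ Sum.inr '' (Subtype.val ⁻¹' B)) ↔
      IsSubdivisionTOIDS G A B := by
  constructor
  · rintro ⟨h₁, h₂⟩
    refine ⟨hB, fun x => ?_, fun x y h => ?_, fun x y h => ?_⟩
    · obtain ⟨z | ⟨e, he⟩, hz, hadj⟩ := h₁ (Sum.inl x)
      · exact absurd hadj (not_subdivision_adj_inl_inl G x z)
      · rw [subdivision_adj_inl_inr] at hadj
        obtain ⟨y, rfl⟩ := Sym2.mem_iff_exists.mp hadj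
        exact ⟨y, he, by simpa using hz⟩
    · obtain ⟨z | e, hz, hadj⟩ := h₁ (Sum.inr ⟨s(x, y), h⟩)
      · rw [adj_comm, subdivision_adj_inl_inr] at hadj
        have hzA : z ∈ A := by simpa using hz
        rcases Sym2.mem_iff.mp hadj with rfl | rfl
        · exact Or.inl hzA
        · exact Or.inr hzA
      · exact absurd hadj (not_subdivision_adj_inr_inr G _ e)
    · by_contra! hcon
      refine h₂ (Sum.inl x) (by simpa using hcon.1) (Sum.inr ⟨s(x, y), h⟩)
        (by simpa using hcon.2) ?_
      rw [subdivision_adj_inl_inr]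
      exact Sym2.mem_mk_left x y
  · intro h
    have key : ∀ (x : V) (e : G.edgeSet), x ∈ (e : Sym2 V) → x ∈ A ∨ (e : Sym2 V) ∈ B := by
      rintro x ⟨e, he⟩ hx
      obtain ⟨y, rfl⟩ := Sym2.mem_iff_exists.mp hx
      exact h.indep x y he
    refine ⟨?_, ?_⟩
    · rintro (x | ⟨e, he⟩)
      · obtain ⟨y, hxy, hy⟩ := h.dom_vertex x
        refine ⟨Sum.inr ⟨s(x, y), hxy⟩, by simpa using hy, ?_⟩
        rw [subdivision_adj_inl_inr]
        exact Sym2.mem_mk_left x y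
      · induction e with | h x y => ?_
        rcases h.dom_edge x y he with hx | hx
        · refine ⟨Sum.inl x, by simpa using hx, ?_⟩
          rw [adj_comm, subdivision_adj_inl_inr]
          exact Sym2.mem_mk_left x y
        · refine ⟨Sum.inl y, by simpa using hx, ?_⟩
          rw [adj_comm, subdivision_adj_inl_inr]
          exact Sym2.mem_mk_right x y
    · rintro (x | e) hx (y | f) hy hadj
      · exact not_subdivision_adj_inl_inl G x y hadj
      · rw [subdivision_adj_inl_inr] at hadj
        have := key x f hadj
        simp_all
      · rw [adj_comm, subdivision_adj_inl_inr] at hadj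
        have := key y e hadj
        simp_all
      · exact not_subdivision_adj_inr_inr G e f hadj

theorem ncard_inl_union_inr {V : Type u} [Finite V] (G : SimpleGraph V) (A : Set V)
    (B : Set (Sym2 V)) (hB : B ⊆ G.edgeSet) :
    (Sum.inl '' A ∪ Sum.inr '' (Subtype.val ⁻¹' B) : Set (V ⊕ G.edgeSet)).ncard =
      A.ncard + B.ncard := by
  rw [Set.ncard_union_eq (by rw [Set.disjoint_left]; rintro _ ⟨a, _, rfl⟩ ⟨b, _, h⟩; cases h)
      (Set.toFinite _) (Set.toFinite _),
    Set.ncard_image_of_injective _ Sum.inl_injective,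
    Set.ncard_image_of_injective _ Sum.inr_injective,
    Set.ncard_preimage_of_injective_subset_range Subtype.val_injective (by simpa using hB)]

theorem toidNumber_subdivision_le {V : Type u} [Finite V] {G : SimpleGraph V} {A : Set V}
    {B : Set (Sym2 V)} (h : IsSubdivisionTOIDS G A B) :
    toidNumber (subdivision G) ≤ A.ncard + B.ncard :=
  Nat.sInf_le ⟨_, (isTOIDS_subdivision_iff G A B h.subset).2 h, ncard_inl_union_inr G A B h.subset⟩

theorem exists_isSubdivisionTOIDS_ncard_eq {V : Type u} [Finite V] {G : SimpleGraph V}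
    (hG : ∃ A B, IsSubdivisionTOIDS G A B) :
    ∃ A B, IsSubdivisionTOIDS G A B ∧ A.ncard + B.ncard = toidNumber (subdivision G) := by
  obtain ⟨A₀, B₀, h₀⟩ := hG
  obtain ⟨D, hD, hcard⟩ : toidNumber (subdivision G) ∈
      {n : ℕ | ∃ D : Set (V ⊕ G.edgeSet), IsTOIDS (subdivision G) D ∧ D.ncard = n} :=
    Nat.sInf_mem ⟨_, _, (isTOIDS_subdivision_iff G A₀ B₀ h₀.subset).2 h₀, rfl⟩
  have hB : Subtype.val '' (Sum.inr ⁻¹' D) ⊆ G.edgeSet := by simp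
  have hDeq : D = Sum.inl '' (Sum.inl ⁻¹' D) ∪
      Sum.inr '' (Subtype.val ⁻¹' (Subtype.val '' (Sum.inr ⁻¹' D))) := by
    ext (x | e) <;> simp
  refine ⟨Sum.inl ⁻¹' D, Subtype.val '' (Sum.inr ⁻¹' D), ?_, ?_⟩
  · rw [← isTOIDS_subdivision_iff G _ _ hB, ← hDeq]
    exact hD
  · rw [← ncard_inl_union_inr G _ _ hB, ← hDeq, hcard]

/-- Restricting to the graph with one of two leaves `v`, `w` at `u` removed. -/
theorem IsSubdivisionTOIDS.remove {V : Type u} [Finite V] {G : SimpleGraph V} {u v w : V}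
    (hvw : v ≠ w) (hv : ∀ y, G.Adj v y ↔ y = u) (hw : ∀ y, G.Adj w y ↔ y = u)
    {A : Set V} {B : Set (Sym2 V)} (h : IsSubdivisionTOIDS G A B) :
    ∃ A' B', IsSubdivisionTOIDS (G.induce {x : V | x ≠ v}) A' B' ∧
      A'.ncard + B'.ncard + 1 ≤ A.ncard + B.ncard := by
  have mem_of_leaf : ∀ {z}, (∀ y, G.Adj z y ↔ y = u) → s(z, u) ∈ B := by
    intro z hz
    obtain ⟨y, hy, hyB⟩ := h.dom_vertex z
    rwa [(hz y).1 hy] at hyB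
  refine ⟨Subtype.val ⁻¹' A, Sym2.map Subtype.val ⁻¹' B, ⟨?_, ?_, ?_, ?_⟩, ?_⟩
  · intro e he
    induction e with | h x y => exact h.subset he
  · rintro ⟨x, hx⟩
    by_cases hxu : x = u
    · subst hxu
      exact ⟨⟨w, hvw.symm⟩, ((hw x).2 rfl).symm, by
        simpa [Sym2.eq_swap] using mem_of_leaf hw⟩
    · obtain ⟨y, hy, hyB⟩ := h.dom_vertex x
      refine ⟨⟨y, ?_⟩, hy, hyB⟩
      rintro rfl
      exact hxu ((hv x).1 hy.symm)
  · rintro x y hxy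
    exact h.dom_edge _ _ hxy
  · rintro x y hxy
    exact h.indep _ _ hxy
  · have hA : (Subtype.val ⁻¹' A : Set {x : V | x ≠ v}).ncard ≤ A.ncard :=
      Set.ncard_le_ncard_of_injOn Subtype.val (fun x hx => hx) Subtype.val_injective.injOn
        (Set.toFinite _)
    have hB : (Sym2.map Subtype.val ⁻¹' B : Set (Sym2 {x : V | x ≠ v})).ncard ≤
        (B \ {s(v, u)}).ncard := by
      refine Set.ncard_le_ncard_of_injOn (Sym2.map Subtype.val) (fun e he => ⟨he, ?_⟩)
        (Sym2.map.injective Subtype.val_injective).injOn (Set.toFinite _)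
      intro heq
      have hmem : v ∈ Sym2.map Subtype.val e := by
        rw [heq]
        exact Sym2.mem_mk_left v u
      obtain ⟨x, -, hx⟩ := Sym2.mem_map.1 hmem
      exact x.2 hx
    have := Set.ncard_sdiff_singleton_add_one (mem_of_leaf hv) (Set.toFinite _)
    omega

/-- Extending to the graph with a second leaf `v` added at the support vertex `u` of `w`. -/
theorem IsSubdivisionTOIDS.extend {V : Type u} [Finite V] {G : SimpleGraph V} {u v w : V}
    (hvw : v ≠ w) (hv : ∀ y, G.Adj v y ↔ y = u) (hw : ∀ y, G.Adj w y ↔ y = u)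
    {A : Set {x : V | x ≠ v}} {B : Set (Sym2 {x : V | x ≠ v})}
    (h : IsSubdivisionTOIDS (G.induce {x : V | x ≠ v}) A B) :
    ∃ A' B', IsSubdivisionTOIDS G A' B' ∧ A'.ncard + B'.ncard ≤ A.ncard + B.ncard + 1 := by
  have hvu : G.Adj v u := (hv u).2 rfl
  have hwu : G.Adj w u := (hw u).2 rfl
  have hAimg : ∀ {x} (hx : x ≠ v), (⟨x, hx⟩ : {x : V | x ≠ v}) ∈ A → x ≠ w →
      x ∈ insert u (Subtype.val '' A \ {w}) :=
    fun hx hA hxw => Or.inr ⟨⟨_, hA, rfl⟩, hxw⟩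
  have hwuB : s(w, u) ∈ Sym2.map Subtype.val '' B := by
    obtain ⟨⟨y, hy⟩, hadj, hyB⟩ := h.dom_vertex ⟨w, hvw.symm⟩
    obtain rfl : y = u := (hw y).1 hadj
    exact ⟨_, hyB, rfl⟩
  refine ⟨insert u (Subtype.val '' A \ {w}), insert s(v, u) (Sym2.map Subtype.val '' B),
    ⟨?_, ?_, ?_, ?_⟩, ?_⟩
  · rintro e (rfl | ⟨e, he, rfl⟩)
    · exact hvu
    · have := h.subset he
      induction e with | h x y => exact this
  · intro x
    by_cases hx : x = v
    · subst hx
      exact ⟨u, hvu, Or.inl rfl⟩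
    · obtain ⟨⟨y, hy⟩, hadj, hyB⟩ := h.dom_vertex ⟨x, hx⟩
      exact ⟨y, hadj, Or.inr ⟨_, hyB, rfl⟩⟩
  · intro x y hxy
    by_cases hxu : x = u
    · exact Or.inl (Or.inl hxu)
    by_cases hyu : y = u
    · exact Or.inr (Or.inl hyu)
    have hxv : x ≠ v := by rintro rfl; exact hyu ((hv y).1 hxy)
    have hyv : y ≠ v := by rintro rfl; exact hxu ((hv x).1 hxy.symm)
    have hxw : x ≠ w := by rintro rfl; exact hyu ((hw y).1 hxy)
    have hyw : y ≠ w := by rintro rfl; exact hxu ((hw x).1 hxy.symm)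
    rcases h.dom_edge ⟨x, hxv⟩ ⟨y, hyv⟩ hxy with hA | hA
    · exact Or.inl (hAimg hxv hA hxw)
    · exact Or.inr (hAimg hyv hA hyw)
  · intro x y hxy
    by_cases hxu : x = u
    · exact Or.inl (Or.inl hxu)
    by_cases hxv : x = v
    · subst hxv
      rw [(hv y).1 hxy]
      exact Or.inr (Or.inl rfl)
    by_cases hxw : x = w
    · subst hxw
      rw [(hw y).1 hxy]
      exact Or.inr (Or.inr hwuB)
    have hyv : y ≠ v := by rintro rfl; exact hxu ((hv x).1 hxy.symm)
    rcases h.indep ⟨x, hxv⟩ ⟨y, hyv⟩ hxy with hA | hB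
    · exact Or.inl (hAimg hxv hA hxw)
    · exact Or.inr (Or.inr ⟨_, hB, rfl⟩)
  · have hA : (insert u (Subtype.val '' A \ {w})).ncard ≤ A.ncard := by
      have himg : (Subtype.val '' A).ncard = A.ncard :=
        Set.ncard_image_of_injective _ Subtype.val_injective
      rw [← himg]
      by_cases hwA : w ∈ Subtype.val '' A
      · have := Set.ncard_sdiff_singleton_add_one hwA (Set.toFinite _)
        have := Set.ncard_insert_le u (Subtype.val '' A \ {w})
        omega
      · rw [Set.sdiff_singleton_eq_self hwA]
        refine Set.ncard_le_ncard (Set.insert_subset ?_ subset_rfl) (Set.toFinite _)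
        have := h.dom_edge ⟨w, hvw.symm⟩ ⟨u, hvu.ne'⟩ hwu
        exact this.elim (fun hw' => absurd ⟨_, hw', rfl⟩ hwA) fun hu => ⟨_, hu, rfl⟩
    have hB := Set.ncard_insert_le s(v, u) (Sym2.map Subtype.val '' B)
    rw [Set.ncard_image_of_injective _ (Sym2.map.injective Subtype.val_injective)] at hB
    omega

theorem toidNumber_subdivision_remove_leaf {V : Type u} [Finite V] {G : SimpleGraph V} {u v w : V}
    (hG : ∀ x, ∃ y, G.Adj x y)
    (hvw : v ≠ w) (hv : ∀ y, G.Adj v y ↔ y = u) (hw : ∀ y, G.Adj w y ↔ y = u) :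
    toidNumber (subdivision (G.induce {x : V | x ≠ v})) + 1 = toidNumber (subdivision G) := by
  have hne : ∃ A B, IsSubdivisionTOIDS G A B :=
    ⟨Set.univ, G.edgeSet, subset_rfl, fun x => (hG x).imp fun y hy => ⟨hy, hy⟩,
      fun _ _ _ => Or.inl trivial, fun _ _ _ => Or.inl trivial⟩
  obtain ⟨A, B, h, hcard⟩ := exists_isSubdivisionTOIDS_ncard_eq hne
  obtain ⟨A', B', h', hcard'⟩ := h.remove hvw hv hw
  obtain ⟨A₁, B₁, h₁, hcard₁⟩ := exists_isSubdivisionTOIDS_ncard_eq ⟨A', B', h'⟩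
  obtain ⟨A₂, B₂, h₂, hcard₂⟩ := h₁.extend hvw hv hw
  have := toidNumber_subdivision_le h'
  have := toidNumber_subdivision_le h₂
  omega

/-- In a connected graph on at least four vertices, a vertex with two leaf neighbors has a third
neighbor. -/
theorem exists_third_adj {V : Type u} [Finite V] {G : SimpleGraph V} {u v w : V}
    (hG : G.Connected) (hv : ∀ y, G.Adj v y ↔ y = u) (hw : ∀ y, G.Adj w y ↔ y = u)
    (hn : 4 ≤ Nat.card V) : ∃ z, G.Adj u z ∧ z ≠ v ∧ z ≠ w := by
  by_contra! hcon
  have hclosed : ∀ {x y}, G.Adj x y → x ∈ ({u, v, w} : Set V) → y ∈ ({u, v, w} : Set V) := by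
    rintro x y hxy (rfl | rfl | rfl)
    · by_cases hyv : y = v
      · simp [hyv]
      · simp [hcon y hxy hyv]
    · simp [(hv y).1 hxy]
    · simp [(hw y).1 hxy]
  have huniv : ({u, v, w} : Set V) = Set.univ := by
    refine Set.eq_univ_of_forall fun x => ?_
    obtain ⟨p⟩ := hG.preconnected x u
    induction p with
    | nil => simp
    | cons hadj _ ih => exact hclosed hadj.symm (ih hv hw hcon hclosed)
  have h₁ := Set.ncard_univ V
  rw [← huniv] at h₁
  have h₂ := Set.ncard_insert_le u {v, w}
  have h₃ := Set.ncard_insert_le v {w}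
  rw [Set.ncard_singleton] at h₃
  omega

theorem isLeafVert_induce_iff {V : Type u} {G : SimpleGraph V} {u v w z : V}
    (hvw : v ≠ w) (hv : ∀ y, G.Adj v y ↔ y = u) (hw : ∀ y, G.Adj w y ↔ y = u)
    (hz : G.Adj u z) (hzv : z ≠ v) (hzw : z ≠ w) (x : {x : V | x ≠ v}) :
    IsLeafVert (G.induce {x : V | x ≠ v}) x ↔ IsLeafVert G x := by
  obtain ⟨x, hx⟩ := x
  by_cases hxu : x = u
  · subst hxu
    refine iff_of_false (fun h => hzw ?_) (fun h => hzw (h.unique hz ((hw x).2 rfl).symm))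
    exact congrArg Subtype.val (h.unique (y₁ := ⟨z, hzv⟩) (y₂ := ⟨w, hvw.symm⟩)
      hz ((hw x).2 rfl).symm)
  · have hne : ∀ {y}, G.Adj x y → y ≠ v := by
      rintro y hy rfl
      exact hxu ((hv x).1 hy.symm)
    constructor
    · rintro ⟨⟨y, hy⟩, hadj, huniq⟩
      exact ⟨y, hadj, fun t ht => congrArg Subtype.val (huniq ⟨t, hne ht⟩ ht)⟩
    · rintro ⟨y, hadj, huniq⟩
      exact ⟨⟨y, hne hadj⟩, hadj, fun t ht => Subtype.ext (huniq t ht)⟩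

theorem leafCount_and_supportCount_remove_leaf {V : Type u} [Finite V] {G : SimpleGraph V}
    {u v w : V} (hG : G.Connected) (hn : 3 ≤ Nat.card V)
    (hvw : v ≠ w) (hv : ∀ y, G.Adj v y ↔ y = u) (hw : ∀ y, G.Adj w y ↔ y = u)
    (hcard : Nat.card {x : V | x ≠ v} + 1 = Nat.card V) :
    leafCount (G.induce {x : V | x ≠ v}) + 1 = leafCount G ∧
      supportCount (G.induce {x : V | x ≠ v}) = supportCount G := by
  have hvu : G.Adj v u := (hv u).2 rfl
  have hwu : G.Adj w u := (hw u).2 rfl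
  have hvleaf : IsLeafVert G v := ⟨u, hvu, fun y hy => (hv y).1 hy⟩
  have hwleaf : IsLeafVert G w := ⟨u, hwu, fun y hy => (hw y).1 hy⟩
  have huleaf : ¬ IsLeafVert G u := fun h => hvw (h.unique hvu.symm hwu.symm)
  have hvsupp : ¬ IsSupportVert G v := by
    rintro ⟨y, hy, hyl⟩
    exact huleaf ((hv y).1 hy ▸ hyl)
  have hwsupp : ¬ IsSupportVert G w := by
    rintro ⟨y, hy, hyl⟩
    exact huleaf ((hw y).1 hy ▸ hyl)
  unfold leafCount supportCount
  rw [if_neg (by omega : Nat.card V ≠ 2), if_neg (by omega : Nat.card V ≠ 2)]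
  by_cases h3 : Nat.card V = 3
  · rw [if_pos (by omega), if_pos (by omega)]
    have huniv : ({u, v, w} : Set V) = Set.univ := by
      refine Set.eq_of_subset_of_ncard_le (Set.subset_univ _) ?_ (Set.toFinite _)
      rw [Set.ncard_univ, h3, Set.ncard_eq_three.2 ⟨u, v, w, hvu.ne', hwu.ne', hvw, rfl⟩]
    have hall : ∀ x, x = u ∨ x = v ∨ x = w := fun x => by
      have : x ∈ ({u, v, w} : Set V) := huniv ▸ trivial
      simpa using this
    have hleaf : {x | IsLeafVert G x} = {v, w} := by
      ext x
      rcases hall x with rfl | rfl | rfl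
      · simp [huleaf, hvu.ne', hwu.ne']
      · simp [hvleaf]
      · simp [hwleaf]
    have hsupp : {x | IsSupportVert G x} = {u} := by
      ext x
      rcases hall x with rfl | rfl | rfl
      · exact iff_of_true ⟨v, hvu.symm, hvleaf⟩ rfl
      · simp [hvsupp, hvu.ne]
      · simp [hwsupp, hwu.ne]
    rw [hleaf, hsupp, Set.ncard_pair hvw, Set.ncard_singleton]
    exact ⟨rfl, rfl⟩
  · rw [if_neg (by omega), if_neg (by omega)]
    obtain ⟨z, hz, hzv, hzw⟩ := exists_third_adj hG hv hw (by omega)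
    have hiff := isLeafVert_induce_iff hvw hv hw hz hzv hzw
    have hleaf : {x | IsLeafVert G x} =
        insert v (Subtype.val '' {x | IsLeafVert (G.induce {x : V | x ≠ v}) x}) := by
      ext x
      by_cases hx : x = v
      · simp [hx, hvleaf]
      · constructor
        · exact fun h => Or.inr ⟨⟨x, hx⟩, (hiff _).2 h, rfl⟩
        · rintro (h | ⟨y, hy, rfl⟩)
          · exact absurd h hx
          · exact (hiff y).1 hy
    have hsupp : {x | IsSupportVert G x} =
        Subtype.val '' {x | IsSupportVert (G.induce {x : V | x ≠ v}) x} := by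
      ext x
      constructor
      · rintro ⟨y, hxy, hy⟩
        have hx : x ≠ v := by
          rintro rfl
          exact hvsupp ⟨y, hxy, hy⟩
        refine ⟨⟨x, hx⟩, ?_, rfl⟩
        by_cases hyv : y = v
        · subst hyv
          obtain rfl : x = u := (hv x).1 hxy.symm
          exact ⟨⟨w, hvw.symm⟩, hwu.symm, (hiff _).2 hwleaf⟩
        · exact ⟨⟨y, hyv⟩, hxy, (hiff _).2 hy⟩
      · rintro ⟨x, ⟨y, hxy, hy⟩, rfl⟩
        exact ⟨y, hxy, (hiff y).1 hy⟩
    rw [hleaf, hsupp, Set.ncard_insert_of_notMem (by rintro ⟨x, -, hx⟩; exact x.2 hx)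
      (Set.toFinite _), Set.ncard_image_of_injective _ Subtype.val_injective,
      Set.ncard_image_of_injective _ Subtype.val_injective]
    exact ⟨rfl, rfl⟩

theorem remove_strong_leaf_upper {V : Type u} [Fintype V]
    (T : SimpleGraph V) (hT : T.IsTree) (hn : 3 ≤ Nat.card V)
    (heq : (toidNumber (subdivision T) : ℚ) = (4 * (Nat.card V : ℚ) - leafCount T + supportCount T - 2) / 3)
    (v : V) (hv : IsStrongLeaf T v) :
    (toidNumber (subdivision (T.induce {x : V | x ≠ v})) : ℚ) = (4 * (Nat.card {x : V | x ≠ v} : ℚ) - leafCount (T.induce {x : V | x ≠ v}) + supportCount (T.induce {x : V | x ≠ v}) - 2) / 3 := by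
  obtain ⟨⟨u, hvu, hvuniq⟩, u', hvu', a, b, hab, hua, hub, ha, hb⟩ := hv
  obtain rfl := hvuniq u' hvu'
  have hleaf : ∀ {z}, T.Adj u' z → IsLeafVert T z → ∀ y, T.Adj z y ↔ y = u' := by
    intro z hz hl y
    refine ⟨fun h => hl.unique h hz.symm, ?_⟩
    rintro rfl
    exact hz.symm
  have hv : ∀ y, T.Adj v y ↔ y = u' := hleaf hvu'.symm ⟨u', hvu', hvuniq⟩
  obtain ⟨w, hvw, hw⟩ : ∃ w, v ≠ w ∧ ∀ y, T.Adj w y ↔ y = u' := by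
    by_cases hva : v = a
    · exact ⟨b, hva ▸ hab, hleaf hub hb⟩
    · exact ⟨a, hva, hleaf hua ha⟩
  have : Nontrivial V := ⟨v, w, hvw⟩
  have hcard : Nat.card {x : V | x ≠ v} + 1 = Nat.card V := by
    have h := Set.ncard_add_ncard_compl ({v} : Set V)
    rw [Set.ncard_singleton, add_comm] at h
    exact h
  have htoid := toidNumber_subdivision_remove_leaf
    (fun x => hT.connected.preconnected.exists_adj_of_nontrivial x) hvw hv hw
  obtain ⟨hl, hs⟩ := leafCount_and_supportCount_remove_leaf hT.connected hn hvw hv hw hcard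
  rw [← htoid, ← hcard, ← hl, ← hs] at heq
  push_cast at heq
  linarith
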